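/- arXiv:2209.13550 — 2 statements merged into one kernel-verified Lean document; each statement's English description precedes it below -/
import Mathlib

section
/- Let k ∈ ℝ, let z ∈ ℝ³, and let x ∈ ℝ³ with x ≠ z. Then for all indices j, r ∈ {1,2,3}, Σ_{ℓ,m,s} ε_{jℓs} ε_{msr} (D_x² G_k(x,z))_{ℓm} = −( (D_x² G_k(x,z))_{jr} + k² δ_{jr} G_k(x,z) ), where (D_x² G_k)_{ℓm} = ∂²G_k/∂x_ℓ∂x_m is the Hessian of G_k in x. -/
/-- The Helmholtz free-space Green's function
`G_k(x,z) = e^{i k ‖x − z‖} / (4π ‖x − z‖)`. -/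
noncomputable def Gk (k : ℝ) (x z : EuclideanSpace ℝ (Fin 3)) : ℂ :=
  Complex.exp (Complex.I * k * ‖x - z‖) / (4 * Real.pi * ‖x - z‖)

/-- The Levi-Civita symbol on three indices. -/
def eps (i j k : Fin 3) : ℤ :=
  if (i, j, k) = (0, 1, 2) ∨ (i, j, k) = (1, 2, 0) ∨ (i, j, k) = (2, 0, 1) then 1
  else if (i, j, k) = (2, 1, 0) ∨ (i, j, k) = (1, 0, 2) ∨ (i, j, k) = (0, 2, 1) then -1
  else 0

/-- The gradient of a radial function `y ↦ φ ‖y - z‖` away from the centre `z`. -/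
lemma hasFDerivAt_radial {φ : ℝ → ℂ} {φ' : ℂ} {x z : EuclideanSpace ℝ (Fin 3)} (hxz : x ≠ z)
    (hφ : HasDerivAt φ φ' ‖x - z‖) :
    HasFDerivAt (fun y => φ ‖y - z‖)
      ((innerSL ℝ (x - z)).smulRight (φ' / (‖x - z‖ : ℂ))) x := by
  have hr : ‖x - z‖ ≠ 0 := norm_ne_zero_iff.2 (sub_ne_zero.2 hxz)
  have hnorm : HasFDerivAt (fun y => ‖y - z‖) (‖x - z‖⁻¹ • innerSL ℝ (x - z)) x := by
    have h := (((hasFDerivAt_id x).sub_const z).norm_sq).sqrt (by simpa using hr)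
    simp only [id, Real.sqrt_sq (norm_nonneg _)] at h
    refine h.congr_fderiv ?_
    ext v
    simp
    field_simp
  refine (hφ.hasFDerivAt.comp x hnorm).congr_fderiv ?_
  ext v
  simp
  ring

/-- The derivative of `exp (i k t) / (4 π t)`, divided by `t`. -/
noncomputable def greenRadialDeriv (k t : ℝ) : ℂ :=
  Complex.exp (Complex.I * k * t) * (Complex.I * k * t - 1) / (4 * Real.pi * t ^ 3)

/-- The derivative of `greenRadialDeriv k`, divided by `t`. -/
noncomputable def greenRadialDeriv₂ (k t : ℝ) : ℂ :=
  Complex.exp (Complex.I * k * t) * (3 - 3 * Complex.I * k * t - k ^ 2 * t ^ 2) /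
    (4 * Real.pi * t ^ 5)

lemma hasDerivAt_exp_I_mul (k t : ℝ) :
    HasDerivAt (fun t : ℝ => Complex.exp (Complex.I * k * t))
      (Complex.exp (Complex.I * k * t) * (Complex.I * k)) t := by
  simpa using ((Complex.ofRealCLM.hasDerivAt (x := t)).const_mul (Complex.I * k)).cexp

lemma hasDerivAt_green (k : ℝ) {t : ℝ} (ht : t ≠ 0) :
    HasDerivAt (fun t : ℝ => Complex.exp (Complex.I * k * t) / (4 * Real.pi * t))
      (t * greenRadialDeriv k t) t := by
  have htc : (t : ℂ) ≠ 0 := Complex.ofReal_ne_zero.2 ht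
  have hpi : (Real.pi : ℂ) ≠ 0 := Complex.ofReal_ne_zero.2 Real.pi_ne_zero
  have hid : HasDerivAt (fun t : ℝ => (t : ℂ)) 1 t := Complex.ofRealCLM.hasDerivAt
  refine ((hasDerivAt_exp_I_mul k t).div (hid.const_mul (4 * Real.pi : ℂ))
    (by simp [ht, Real.pi_ne_zero])).congr_deriv ?_
  unfold greenRadialDeriv
  field_simp

lemma hasDerivAt_greenRadialDeriv (k : ℝ) {t : ℝ} (ht : t ≠ 0) :
    HasDerivAt (greenRadialDeriv k) (t * greenRadialDeriv₂ k t) t := by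
  have htc : (t : ℂ) ≠ 0 := Complex.ofReal_ne_zero.2 ht
  have hpi : (Real.pi : ℂ) ≠ 0 := Complex.ofReal_ne_zero.2 Real.pi_ne_zero
  have hid : HasDerivAt (fun t : ℝ => (t : ℂ)) 1 t := Complex.ofRealCLM.hasDerivAt
  refine (((hasDerivAt_exp_I_mul k t).mul ((hid.const_mul (Complex.I * k)).sub_const 1)).div
    ((hid.pow 3).const_mul (4 * Real.pi : ℂ)) (by simp [ht, Real.pi_ne_zero])).congr_deriv ?_
  unfold greenRadialDeriv₂
  simp only [Pi.pow_apply, Pi.mul_apply]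
  field_simp
  ring_nf
  simp only [Complex.I_sq]
  ring

lemma fderiv_Gk (k : ℝ) {x z : EuclideanSpace ℝ (Fin 3)} (hxz : x ≠ z) (m : Fin 3) :
    fderiv ℝ (fun w => Gk k w z) x (EuclideanSpace.single m 1) =
      ((x m - z m : ℝ) : ℂ) * greenRadialDeriv k ‖x - z‖ := by
  have hr : ‖x - z‖ ≠ 0 := norm_ne_zero_iff.2 (sub_ne_zero.2 hxz)
  have hrc : (‖x - z‖ : ℂ) ≠ 0 := Complex.ofReal_ne_zero.2 hr
  have h : HasFDerivAt (fun w => Gk k w z) _ x :=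
    hasFDerivAt_radial hxz (hasDerivAt_green k hr)
  rw [h.fderiv]
  simp [EuclideanSpace.inner_single_right, mul_div_cancel_left₀ _ hrc]

/-- The Hessian of the Green's function. -/
lemma fderiv_fderiv_Gk (k : ℝ) {x z : EuclideanSpace ℝ (Fin 3)} (hxz : x ≠ z) (l m : Fin 3) :
    fderiv ℝ (fun y => fderiv ℝ (fun w => Gk k w z) y (EuclideanSpace.single m 1)) x
        (EuclideanSpace.single l 1) =
      ((x l - z l : ℝ) : ℂ) * ((x m - z m : ℝ) : ℂ) * greenRadialDeriv₂ k ‖x - z‖ +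
        (if l = m then 1 else 0) * greenRadialDeriv k ‖x - z‖ := by
  have hr : ‖x - z‖ ≠ 0 := norm_ne_zero_iff.2 (sub_ne_zero.2 hxz)
  have hrc : (‖x - z‖ : ℂ) ≠ 0 := Complex.ofReal_ne_zero.2 hr
  have heq : (fun y => fderiv ℝ (fun w => Gk k w z) y (EuclideanSpace.single m 1)) =ᶠ[nhds x]
      fun y => ((y m - z m : ℝ) : ℂ) * greenRadialDeriv k ‖y - z‖ := by
    filter_upwards [isOpen_ne.mem_nhds hxz] with y hy using fderiv_Gk k hy m
  have hcoord : HasFDerivAt (fun y : EuclideanSpace ℝ (Fin 3) => ((y m - z m : ℝ) : ℂ))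
      (Complex.ofRealCLM.comp (EuclideanSpace.proj m : EuclideanSpace ℝ (Fin 3) →L[ℝ] ℝ)) x :=
    Complex.ofRealCLM.hasFDerivAt.comp x
      ((EuclideanSpace.proj m : EuclideanSpace ℝ (Fin 3) →L[ℝ] ℝ).hasFDerivAt.sub_const (z m))
  have hprod : HasFDerivAt (fun y => ((y m - z m : ℝ) : ℂ) * greenRadialDeriv k ‖y - z‖) _ x :=
    hcoord.mul (hasFDerivAt_radial hxz (hasDerivAt_greenRadialDeriv k hr))
  rw [heq.fderiv_eq, hprod.fderiv]
  simp [EuclideanSpace.inner_single_right, mul_div_cancel_left₀ _ hrc, eq_comm (a := m)]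
  split_ifs <;> push_cast <;> ring

/-- The radial form of the Helmholtz equation `Δ G_k = -k² G_k`. -/
lemma greenRadialDeriv_helmholtz (k : ℝ) {x z : EuclideanSpace ℝ (Fin 3)} (hxz : x ≠ z) :
    (‖x - z‖ : ℂ) ^ 2 * greenRadialDeriv₂ k ‖x - z‖ + 3 * greenRadialDeriv k ‖x - z‖ =
      -(k : ℂ) ^ 2 * Gk k x z := by
  have hrc : (‖x - z‖ : ℂ) ≠ 0 :=
    Complex.ofReal_ne_zero.2 (norm_ne_zero_iff.2 (sub_ne_zero.2 hxz))
  have hpi : (Real.pi : ℂ) ≠ 0 := Complex.ofReal_ne_zero.2 Real.pi_ne_zero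
  unfold greenRadialDeriv greenRadialDeriv₂ Gk
  field_simp
  ring

/-- `Σ_{ℓ,m,s} ε_{jℓs} ε_{msr} (D_x²G_k)_{ℓm} = −((D_x²G_k)_{jr} + k² δ_{jr} G_k)`. -/
theorem levi_civita_contraction_hessian_Gk (k : ℝ) (z x : EuclideanSpace ℝ (Fin 3))
    (hxz : x ≠ z) :
    ∀ j r : Fin 3,
      (∑ l : Fin 3, ∑ m : Fin 3, ∑ s : Fin 3,
          (eps j l s : ℂ) * (eps m s r : ℂ) *
            fderiv ℝ (fun y => fderiv ℝ (fun w => Gk k w z) y (EuclideanSpace.single m 1)) x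
              (EuclideanSpace.single l 1)) =
        -(fderiv ℝ (fun y => fderiv ℝ (fun w => Gk k w z) y (EuclideanSpace.single r 1)) x
            (EuclideanSpace.single j 1)
          + (k : ℂ) ^ 2 * (if j = r then 1 else 0) * Gk k x z) := by
  intro j r
  have hnorm : (‖x - z‖ : ℂ) ^ 2 = ∑ i : Fin 3, ((x i - z i : ℝ) : ℂ) ^ 2 := by
    rw [← Complex.ofReal_pow, EuclideanSpace.real_norm_sq_eq]
    simp
  have hhelm := greenRadialDeriv_helmholtz k hxz
  rw [hnorm, Fin.sum_univ_three] at hhelm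
  simp only [fderiv_fderiv_Gk k hxz, Fin.sum_univ_three]
  fin_cases j <;> fin_cases r <;> simp [eps, -mul_eq_mul_right_iff] at hhelm ⊢ <;>
    first | ring1 | linear_combination hhelm
end

section
/- Let k ∈ ℝ, let z ∈ ℝ³, let x ∈ ℝ³ with x ≠ z, and let m ∈ ℂ³. Write r = ‖x − z‖ and r̂ = (x − z)/r (regarded as a vector in ℂ³). Then the vector (D_x² G_k(x,z)) m + k² G_k(x,z) m, where D_x² G_k is the Hessian of G_k in x acting on m componentwise, equals (e^{i k r}/(4π)) [ (1/r³)(3 (r̂·m) r̂ − m) − (i k / r²)(3 (r̂·m) r̂ − m) − (k²/r)((r̂·m) r̂ − m) ], where r̂·m = Σ_i r̂_i m_i. -/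
/-- The unit vector `r̂ = (x − z)/‖x − z‖`, viewed in `ℂ³`. -/
noncomputable def rhat (x z : EuclideanSpace ℝ (Fin 3)) : Fin 3 → ℂ :=
  fun i => (((x - z) i / ‖x - z‖ : ℝ) : ℂ)

section

variable {E : Type*} [NormedAddCommGroup E] [InnerProductSpace ℝ E]

theorem hasFDerivAt_norm_sub {x z : E} (hxz : x ≠ z) :
    HasFDerivAt (fun y => ‖y - z‖) (‖x - z‖⁻¹ • innerSL ℝ (x - z)) x := by
  have hr : ‖x - z‖ ≠ 0 := norm_ne_zero_iff.2 (sub_ne_zero.2 hxz)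
  have h := (((hasFDerivAt_id x).sub_const z).norm_sq).sqrt (pow_ne_zero 2 hr)
  simp only [id, Real.sqrt_sq (norm_nonneg _)] at h
  convert h using 1
  ext v
  simp
  field_simp

/-- The Fréchet derivative of a radial function. -/
theorem HasDerivAt.hasFDerivAt_radial {F : Type*} [NormedAddCommGroup F] [NormedSpace ℝ F]
    {f : ℝ → F} {f' : F} {x z : E} (hf : HasDerivAt f f' ‖x - z‖) (hxz : x ≠ z) :
    HasFDerivAt (fun y => f ‖y - z‖)
      ((‖x - z‖⁻¹ • innerSL ℝ (x - z)).smulRight f') x :=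
  (hf.hasFDerivAt.comp x (hasFDerivAt_norm_sub hxz)).congr_fderiv
    (by ext; simp [smul_smul, smul_sub, sub_smul])

end

theorem hasDerivAt_cexp_I_mul (k r : ℝ) :
    HasDerivAt (fun s : ℝ => Complex.exp (Complex.I * k * s))
      (Complex.exp (Complex.I * k * r) * (Complex.I * k)) r := by
  simpa using ((hasDerivAt_id r).ofReal_comp.const_mul (Complex.I * k)).cexp

/-- The derivative of `r ↦ e^{ikr} / (4πr)`. -/
theorem hasDerivAt_greenProfile (k : ℝ) {r : ℝ} (hr : r ≠ 0) :
    HasDerivAt (fun s : ℝ => Complex.exp (Complex.I * k * s) / (4 * Real.pi * s))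
      (Complex.exp (Complex.I * k * r) * (Complex.I * k * r - 1) / (4 * Real.pi * r ^ 2)) r := by
  have hr' : (r : ℂ) ≠ 0 := Complex.ofReal_ne_zero.2 hr
  have hpi : (Real.pi : ℂ) ≠ 0 := Complex.ofReal_ne_zero.2 Real.pi_ne_zero
  have hd : HasDerivAt (fun s : ℝ => 4 * (Real.pi : ℂ) * s) (4 * Real.pi) r := by
    simpa using (hasDerivAt_id r).ofReal_comp.const_mul (4 * (Real.pi : ℂ))
  refine ((hasDerivAt_cexp_I_mul k r).div hd (by simp [hr, Real.pi_ne_zero])).congr_deriv ?_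
  field_simp

theorem hasDerivAt_greenGradientProfile (k : ℝ) {r : ℝ} (hr : r ≠ 0) :
    HasDerivAt
      (fun s : ℝ => Complex.exp (Complex.I * k * s) * (Complex.I * k * s - 1) /
        (4 * Real.pi * s ^ 3))
      (Complex.exp (Complex.I * k * r) * (3 - 3 * Complex.I * k * r - k ^ 2 * r ^ 2) /
        (4 * Real.pi * r ^ 4)) r := by
  have hr' : (r : ℂ) ≠ 0 := Complex.ofReal_ne_zero.2 hr
  have hpi : (Real.pi : ℂ) ≠ 0 := Complex.ofReal_ne_zero.2 Real.pi_ne_zero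
  have hn : HasDerivAt (fun s : ℝ => Complex.I * k * s - 1) (Complex.I * k) r := by
    simpa using ((hasDerivAt_id r).ofReal_comp.const_mul (Complex.I * k)).sub_const 1
  have hd : HasDerivAt (fun s : ℝ => 4 * (Real.pi : ℂ) * (s : ℂ) ^ 3)
      (4 * (Real.pi : ℂ) * (3 * (r : ℂ) ^ 2)) r := by
    simpa using ((hasDerivAt_id r).ofReal_comp.pow 3).const_mul (4 * (Real.pi : ℂ))
  refine (((hasDerivAt_cexp_I_mul k r).mul hn).div hd
    (by simp [hr, Real.pi_ne_zero])).congr_deriv ?_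
  simp only [Pi.mul_apply]
  field_simp
  linear_combination ((k : ℂ) ^ 2 * r ^ 2) * Complex.I_sq

theorem fderiv_Gk_single (k : ℝ) {y z : EuclideanSpace ℝ (Fin 3)} (hyz : y ≠ z) (j : Fin 3) :
    fderiv ℝ (fun w => Gk k w z) y (EuclideanSpace.single j 1) =
      Complex.exp (Complex.I * k * ‖y - z‖) * (Complex.I * k * ‖y - z‖ - 1) /
        (4 * Real.pi * ‖y - z‖ ^ 3) * ((y - z) j : ℝ) := by
  have hr : ‖y - z‖ ≠ 0 := norm_ne_zero_iff.2 (sub_ne_zero.2 hyz)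
  have hr' : (‖y - z‖ : ℂ) ≠ 0 := Complex.ofReal_ne_zero.2 hr
  have hpi : (Real.pi : ℂ) ≠ 0 := Complex.ofReal_ne_zero.2 Real.pi_ne_zero
  have h : HasFDerivAt (fun w => Gk k w z) _ y :=
    (hasDerivAt_greenProfile k hr).hasFDerivAt_radial hyz
  rw [h.fderiv]
  simp [EuclideanSpace.inner_single_right]
  field_simp

/-- The entries of the Hessian of `G_k`. -/
theorem fderiv_fderiv_Gk_single (k : ℝ) {x z : EuclideanSpace ℝ (Fin 3)} (hxz : x ≠ z)
    (i j : Fin 3) :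
    fderiv ℝ (fun y => fderiv ℝ (fun w => Gk k w z) y (EuclideanSpace.single j 1)) x
        (EuclideanSpace.single i 1) =
      Complex.exp (Complex.I * k * ‖x - z‖) / (4 * Real.pi) *
        ((3 - 3 * Complex.I * k * ‖x - z‖ - k ^ 2 * ‖x - z‖ ^ 2) / ‖x - z‖ ^ 3 *
            (rhat x z i * rhat x z j)
          + (Complex.I * k * ‖x - z‖ - 1) / ‖x - z‖ ^ 3 * if i = j then 1 else 0) := by
  have hr : ‖x - z‖ ≠ 0 := norm_ne_zero_iff.2 (sub_ne_zero.2 hxz)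
  have hr' : (‖x - z‖ : ℂ) ≠ 0 := Complex.ofReal_ne_zero.2 hr
  have hpi : (Real.pi : ℂ) ≠ 0 := Complex.ofReal_ne_zero.2 Real.pi_ne_zero
  have heq : (fun y => fderiv ℝ (fun w => Gk k w z) y (EuclideanSpace.single j 1)) =ᶠ[nhds x]
      fun y => Complex.exp (Complex.I * k * ‖y - z‖) * (Complex.I * k * ‖y - z‖ - 1) /
        (4 * Real.pi * ‖y - z‖ ^ 3) * ((y - z) j : ℝ) := by
    filter_upwards [isOpen_ne.mem_nhds hxz] with y hy using fderiv_Gk_single k hy j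
  have hcoord : HasFDerivAt (fun y : EuclideanSpace ℝ (Fin 3) => (((y - z) j : ℝ) : ℂ))
      (Complex.ofRealCLM.comp (EuclideanSpace.proj j)) x :=
    (Complex.ofRealCLM.comp (EuclideanSpace.proj j)).hasFDerivAt.comp x
      ((hasFDerivAt_id x).sub_const z)
  have hprod : HasFDerivAt (fun y => Complex.exp (Complex.I * k * ‖y - z‖) *
      (Complex.I * k * ‖y - z‖ - 1) / (4 * Real.pi * ‖y - z‖ ^ 3) * ((y - z) j : ℝ)) _ x :=
    ((hasDerivAt_greenGradientProfile k hr).hasFDerivAt_radial hxz).mul hcoord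
  rw [heq.fderiv_eq, hprod.fderiv]
  by_cases hij : i = j
  · subst hij
    simp [EuclideanSpace.inner_single_right, rhat]
    field_simp
    ring
  · simp [EuclideanSpace.inner_single_right, rhat, hij, Ne.symm hij]
    field_simp

/-- The vector `(D_x²G_k) m + k² G_k m` equals
`(e^{ikr}/(4π)) [ (1/r³)(3 (r̂·m) r̂ − m) − (ik/r²)(3 (r̂·m) r̂ − m) − (k²/r)((r̂·m) r̂ − m) ]`. -/
theorem hessian_Gk_apply (k : ℝ) (z x : EuclideanSpace ℝ (Fin 3)) (hxz : x ≠ z)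
    (m : Fin 3 → ℂ) :
    ∀ i : Fin 3,
      (∑ r : Fin 3,
          fderiv ℝ (fun y => fderiv ℝ (fun w => Gk k w z) y (EuclideanSpace.single r 1)) x
            (EuclideanSpace.single i 1) * m r)
        + (k : ℂ) ^ 2 * Gk k x z * m i =
      Complex.exp (Complex.I * k * ‖x - z‖) / (4 * Real.pi) *
        ((1 / (‖x - z‖ : ℂ) ^ 3) *
            (3 * (∑ t : Fin 3, rhat x z t * m t) * rhat x z i - m i)
          - Complex.I * k / (‖x - z‖ : ℂ) ^ 2 *
            (3 * (∑ t : Fin 3, rhat x z t * m t) * rhat x z i - m i)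
          - (k : ℂ) ^ 2 / (‖x - z‖ : ℂ) *
            ((∑ t : Fin 3, rhat x z t * m t) * rhat x z i - m i)) := by
  intro i
  have hr : (‖x - z‖ : ℂ) ≠ 0 :=
    Complex.ofReal_ne_zero.2 (norm_ne_zero_iff.2 (sub_ne_zero.2 hxz))
  have hpi : (Real.pi : ℂ) ≠ 0 := Complex.ofReal_ne_zero.2 Real.pi_ne_zero
  simp only [fderiv_fderiv_Gk_single k hxz]
  have hsum (c a b : ℂ) :
      ∑ j, c * (a * (rhat x z i * rhat x z j) + b * if i = j then 1 else 0) * m j =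
        c * (a * (∑ t, rhat x z t * m t) * rhat x z i + b * m i) := by
    have hdelta : m i = ∑ j, (if i = j then 1 else 0) * m j := by simp
    rw [hdelta, mul_assoc, Finset.sum_mul]
    simp only [Finset.mul_sum, ← Finset.sum_add_distrib]
    exact Finset.sum_congr rfl fun j _ => by ring
  rw [hsum, Gk]
  field_simp
  ring
end
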